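/- arXiv:2410.13614 — 3 statements merged into one kernel-verified Lean document; each statement's English description precedes it below -/
import Mathlib

section
/- Let (X, f_{1,∞}) be a non-autonomous discrete system on a metric space X without isolated points, with f_{1,∞} commutative. If (X, f_{1,∞}) is point transitive and has a fixed point, then there exists a dense G_δ subset B of X × X such that for every (x₁, x₂) ∈ B, liminf_{n→∞} d(f_1^n(x₁), f_1^n(x₂)) = 0. -/
/-- `compSeq f i n = f (i+n-1) ∘ ⋯ ∘ f i` (0-based indexing; `compSeq f 0 n = f_1^n`). -/
def compSeq {X : Type*} (f : ℕ → X → X) (i : ℕ) : ℕ → X → X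
  | 0 => id
  | n + 1 => f (i + n) ∘ compSeq f i n

/-- Orbit of `x` under the non-autonomous system: `{f_1^n(x) : n ≥ 0}`. -/
def NDSOrbit {X : Type*} (f : ℕ → X → X) (x : X) : Set X :=
  Set.range fun n => compSeq f 0 n x

theorem compSeq_continuous {X : Type*} [TopologicalSpace X] {f : ℕ → X → X}
    (hcont : ∀ n, Continuous (f n)) (i n : ℕ) : Continuous (compSeq f i n) := by
  induction n with
  | zero => exact continuous_id
  | succ n ih => exact (hcont (i + n)).comp ih

theorem compSeq_fixed {X : Type*} {f : ℕ → X → X} {v : X} (hv : ∀ n, f n v = v) (i n : ℕ) :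
    compSeq f i n v = v := by
  induction n with
  | zero => rfl
  | succ n ih => simp [compSeq, ih, hv]

theorem Function.Commute.compSeq_right {X : Type*} {f : ℕ → X → X} {g : X → X}
    (hg : ∀ n, Function.Commute g (f n)) (i n : ℕ) : Function.Commute g (compSeq f i n) := by
  induction n with
  | zero => exact Function.Semiconj.id_right
  | succ n ih => exact (hg (i + n)).comp_right ih

theorem compSeq_commute {X : Type*} {f : ℕ → X → X} (hcomm : ∀ i j, Function.Commute (f i) (f j))
    (i m j n : ℕ) : Function.Commute (compSeq f i m) (compSeq f j n) :=
  Function.Commute.compSeq_right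
    (fun k => (Function.Commute.compSeq_right (fun l => hcomm k l) i m).symm) j n

/-- In a T1 space without isolated points, a sequence with dense range visits every
neighbourhood of every point infinitely often. -/
theorem frequently_mem_nhds_of_denseRange {X : Type*} [TopologicalSpace X] [T1Space X]
    [∀ x : X, Filter.NeBot (nhdsWithin x {x}ᶜ)] {u : ℕ → X} (hu : DenseRange u) {v : X}
    {s : Set X} (hs : s ∈ nhds v) : ∃ᶠ n in Filter.atTop, u n ∈ s := by
  rw [Filter.frequently_atTop]
  intro N
  have hd : Dense (Set.range u \ u '' Set.Iio N) :=
    Dense.sdiff_finite hu ((Set.finite_Iio N).image u)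
  obtain ⟨_, hys, ⟨n, rfl⟩, hn⟩ := mem_closure_iff_nhds.1 (hd v) s hs
  exact ⟨n, not_lt.1 fun h => hn ⟨n, h, rfl⟩, hys⟩

theorem liminf_eq_zero_of_frequently_lt {u : ℕ → ℝ} (h0 : ∀ n, 0 ≤ u n)
    (h : ∀ ε > 0, ∃ᶠ n in Filter.atTop, u n < ε) : Filter.liminf u Filter.atTop = 0 := by
  rw [Filter.liminf_eq]
  refine IsGreatest.csSup_eq ⟨Filter.Eventually.of_forall h0, fun a ha => ?_⟩
  by_contra! hpos
  obtain ⟨n, hn, hn'⟩ := ((h a hpos).and_eventually ha).exists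
  exact hn.not_ge hn'

theorem isGδ_setOf_frequently_lt {Y : Type*} [TopologicalSpace Y] {u : ℕ → Y → ℝ}
    (hu : ∀ n, Continuous (u n)) :
    IsGδ {p | ∀ ε > 0, ∃ᶠ n in Filter.atTop, u n p < ε} := by
  have h : {p | ∀ ε > 0, ∃ᶠ n in Filter.atTop, u n p < ε} =
      ⋂ (k : ℕ) (N : ℕ), ⋃ n ≥ N, {p | u n p < 1 / ((k : ℝ) + 1)} := by
    ext p
    simp only [Set.mem_ofPred_eq, Set.mem_iInter, Set.mem_iUnion, Filter.frequently_atTop,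
      exists_prop]
    refine ⟨fun H k => H _ Nat.one_div_pos_of_nat, fun H ε hε N => ?_⟩
    obtain ⟨k, hk⟩ := exists_nat_one_div_lt hε
    obtain ⟨n, hn, hlt⟩ := H k N
    exact ⟨n, hn, hlt.trans hk⟩
  rw [h]
  exact .iInter fun k => .iInter fun N => IsOpen.isGδ <|
    isOpen_biUnion fun n _ => isOpen_lt (hu n) continuous_const

/-- for a commutative NDS without isolated points which is point
transitive and has a fixed point, there is a dense `Gδ` set `B ⊆ X × X` of
proximal pairs (pairs with `liminf dist = 0`). -/
theorem stmt1 {X : Type*} [MetricSpace X]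
    (hiso : ∀ x : X, Filter.NeBot (nhdsWithin x {x}ᶜ))
    (f : ℕ → X → X) (hcont : ∀ n, Continuous (f n))
    (hcomm : ∀ i j, f i ∘ f j = f j ∘ f i)
    (hpt : ∃ x : X, Dense (NDSOrbit f x))
    (hfix : ∃ v : X, ∀ n, f n v = v) :
    ∃ B : Set (X × X), IsGδ B ∧ Dense B ∧ ∀ p ∈ B,
      Filter.liminf (fun n => dist (compSeq f 0 n p.1) (compSeq f 0 n p.2))
        Filter.atTop = 0 := by
  obtain ⟨x, hx⟩ := hpt
  obtain ⟨v, hv⟩ := hfix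
  have hcommute : ∀ i j, Function.Commute (f i) (f j) := fun i j => congrFun (hcomm i j)
  refine ⟨{p | ∀ ε > 0, ∃ᶠ n in Filter.atTop,
      dist (compSeq f 0 n p.1) (compSeq f 0 n p.2) < ε}, isGδ_setOf_frequently_lt fun n => ?_,
    (hx.prod hx).mono ?_,
    fun p hp => liminf_eq_zero_of_frequently_lt (fun _ => dist_nonneg) hp⟩
  · have := compSeq_continuous hcont 0 n
    fun_prop
  · rintro ⟨_, _⟩ ⟨⟨a, rfl⟩, ⟨b, rfl⟩⟩ ε hε
    have hs : {y | dist (compSeq f 0 a y) (compSeq f 0 b y) < ε} ∈ nhds v :=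
      (isOpen_lt ((compSeq_continuous hcont 0 a).dist (compSeq_continuous hcont 0 b))
        continuous_const).mem_nhds (by simpa [compSeq_fixed hv] using hε)
    refine (frequently_mem_nhds_of_denseRange hx hs).mono fun n hn => ?_
    simpa only [Set.mem_ofPred_eq, compSeq_commute hcommute 0 a 0 n x,
      compSeq_commute hcommute 0 b 0 n x] using hn
end

section
/- Let (X, f_{1,∞}) be a k-periodic non-autonomous discrete system on a metric space X and let g = f_k ∘ f_{k-1} ∘ ⋯ ∘ f_1. (i) If the autonomous system (X, g) is syndetically sensitive (respectively, ergodically sensitive), then (X, f_{1,∞}) is syndetically sensitive (respectively, ergodically sensitive). (ii) Conversely, if each f_p (p = 1, …, k) is uniformly continuous and (X, f_{1,∞}) is syndetically sensitive (respectively, ergodically sensitive), then (X, g) is syndetically sensitive (respectively, ergodically sensitive). -/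
/-- A set of natural numbers is syndetic (has bounded gaps). -/
def Syndetic (A : Set ℕ) : Prop :=
  ∃ M : ℕ, ∀ i : ℕ, ∃ j ∈ A, i ≤ j ∧ j ≤ i + M

/-- The upper density of a set of natural numbers. -/
noncomputable def upperDensity (A : Set ℕ) : ℝ :=
  Filter.limsup (fun n : ℕ => (Nat.card ↥(A ∩ Set.Iio n) : ℝ) / n) Filter.atTop

/-- `N_{f_{1,∞}}(U, δ)` for an NDS. -/
def NDSSensTimes {X : Type*} [MetricSpace X] (f : ℕ → X → X) (U : Set X) (δ : ℝ) : Set ℕ :=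
  {n : ℕ | 0 < n ∧ ∃ x ∈ U, ∃ y ∈ U, δ < dist (compSeq f 0 n x) (compSeq f 0 n y)}

/-- `N_g(U, δ)` for an autonomous system. -/
def AutSensTimes {X : Type*} [MetricSpace X] (g : X → X) (U : Set X) (δ : ℝ) : Set ℕ :=
  {n : ℕ | 0 < n ∧ ∃ x ∈ U, ∃ y ∈ U, δ < dist (g^[n] x) (g^[n] y)}

/-- Syndetic sensitivity of an NDS. -/
def NDSSyndeticallySensitive {X : Type*} [MetricSpace X] (f : ℕ → X → X) : Prop :=
  ∃ δ > (0 : ℝ), ∀ U : Set X, IsOpen U → U.Nonempty → Syndetic (NDSSensTimes f U δ)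

/-- Syndetic sensitivity of an autonomous system. -/
def AutSyndeticallySensitive {X : Type*} [MetricSpace X] (g : X → X) : Prop :=
  ∃ δ > (0 : ℝ), ∀ U : Set X, IsOpen U → U.Nonempty → Syndetic (AutSensTimes g U δ)

/-- Ergodic sensitivity of an NDS: sensitive time sets have positive upper density. -/
def NDSErgodicallySensitive {X : Type*} [MetricSpace X] (f : ℕ → X → X) : Prop :=
  ∃ δ > (0 : ℝ), ∀ U : Set X, IsOpen U → U.Nonempty → 0 < upperDensity (NDSSensTimes f U δ)

/-- Ergodic sensitivity of an autonomous system. -/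
def AutErgodicallySensitive {X : Type*} [MetricSpace X] (g : X → X) : Prop :=
  ∃ δ > (0 : ℝ), ∀ U : Set X, IsOpen U → U.Nonempty → 0 < upperDensity (AutSensTimes g U δ)

theorem compSeq_mul_add {X : Type*} {k : ℕ} {f : ℕ → X → X} (hper : ∀ n, f (n + k) = f n)
    (m r : ℕ) : compSeq f 0 (k * m + r) = compSeq f 0 r ∘ (compSeq f 0 k)^[m] := by
  have hmul : ∀ m n, f (k * m + n) = f n := by
    intro m n
    induction m with
    | zero => simp
    | succ m ih => rw [← ih, ← hper (k * m + n)]; congr 1; ring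
  have hadd : ∀ m r, compSeq f 0 (k * m + r) = compSeq f 0 r ∘ compSeq f 0 (k * m) := by
    intro m r
    induction r with
    | zero => rfl
    | succ r ih =>
      rw [← add_assoc]
      simp only [compSeq, ih, zero_add, hmul, Function.comp_assoc]
  have hiter : ∀ m, compSeq f 0 (k * m) = (compSeq f 0 k)^[m] := by
    intro m
    induction m with
    | zero => rfl
    | succ m ih => rw [mul_add, mul_one, hadd, ih, Function.iterate_succ']
  rw [hadd, hiter]

theorem compSeq_mul {X : Type*} {k : ℕ} {f : ℕ → X → X} (hper : ∀ n, f (n + k) = f n)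
    (m : ℕ) : compSeq f 0 (k * m) = (compSeq f 0 k)^[m] :=
  compSeq_mul_add hper m 0

theorem uniformContinuous_compSeq {X : Type*} [UniformSpace X] {f : ℕ → X → X} {k : ℕ}
    (h : ∀ p, p < k → UniformContinuous (f p)) {r : ℕ} (hr : r ≤ k) :
    UniformContinuous (compSeq f 0 r) := by
  induction r with
  | zero => exact uniformContinuous_id
  | succ r ih =>
    simp only [compSeq, zero_add]
    exact (h r (by omega)).comp (ih (by omega))

theorem exists_dist_compSeq_lt {X : Type*} [MetricSpace X] {f : ℕ → X → X} {k : ℕ}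
    (h : ∀ p, p < k → UniformContinuous (f p)) {δ : ℝ} (hδ : 0 < δ) :
    ∃ η > (0 : ℝ), ∀ r < k, ∀ x y, dist x y ≤ η →
      dist (compSeq f 0 r x) (compSeq f 0 r y) < δ := by
  have key : ∀ᶠ p in uniformity X, ∀ r ∈ Finset.range k,
      dist (compSeq f 0 r p.1) (compSeq f 0 r p.2) < δ := by
    rw [Filter.eventually_all_finset]
    intro r hr
    exact uniformContinuous_compSeq h (Finset.mem_range.1 hr).le (Metric.dist_mem_uniformity hδ)
  obtain ⟨ε, hε, H⟩ := Metric.mem_uniformity_dist.1 key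
  refine ⟨ε / 2, half_pos hε, fun r hr x y hxy => ?_⟩
  exact H (a := x) (b := y) (by linarith) r (Finset.mem_range.2 hr)

theorem mul_mem_NDSSensTimes {X : Type*} [MetricSpace X] {k : ℕ} (hk : 0 < k)
    {f : ℕ → X → X} (hper : ∀ n, f (n + k) = f n) {U : Set X} {δ : ℝ} {n : ℕ}
    (hn : n ∈ AutSensTimes (compSeq f 0 k) U δ) : k * n ∈ NDSSensTimes f U δ := by
  obtain ⟨hpos, x, hx, y, hy, hxy⟩ := hn
  exact ⟨Nat.mul_pos hk hpos, x, hx, y, hy, by rwa [compSeq_mul hper]⟩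

theorem div_mem_AutSensTimes {X : Type*} [MetricSpace X] {k : ℕ} (hk : 0 < k)
    {f : ℕ → X → X} (hper : ∀ n, f (n + k) = f n) {U : Set X} {δ η : ℝ}
    (hη : ∀ r < k, ∀ x y, dist x y ≤ η → dist (compSeq f 0 r x) (compSeq f 0 r y) < δ)
    {n : ℕ} (hkn : k ≤ n) (hn : n ∈ NDSSensTimes f U δ) :
    n / k ∈ AutSensTimes (compSeq f 0 k) U η := by
  obtain ⟨-, x, hx, y, hy, hxy⟩ := hn
  refine ⟨Nat.div_pos hkn hk, x, hx, y, hy, ?_⟩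
  by_contra! hle
  rw [← Nat.div_add_mod n k, compSeq_mul_add hper] at hxy
  exact hxy.not_gt (hη _ (Nat.mod_lt _ hk) _ _ hle)

theorem Syndetic.of_mul_mem {A B : Set ℕ} {k : ℕ} (hk : 0 < k) (h : ∀ n ∈ A, k * n ∈ B)
    (hA : Syndetic A) : Syndetic B := by
  obtain ⟨M, hM⟩ := hA
  refine ⟨k * (M + 1), fun i => ?_⟩
  obtain ⟨j, hj, hij, hji⟩ := hM (i / k + 1)
  refine ⟨k * j, h j hj, ?_, ?_⟩
  · exact (Nat.lt_mul_div_succ i hk).le.trans (Nat.mul_le_mul_left k hij)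
  · calc k * j ≤ k * (i / k + 1 + M) := Nat.mul_le_mul_left k hji
      _ = k * (i / k) + k * (M + 1) := by ring
      _ ≤ i + k * (M + 1) := by gcongr; exact Nat.mul_div_le i k

theorem Syndetic.of_div_mem {A B : Set ℕ} {k : ℕ} (hk : 0 < k)
    (h : ∀ n ∈ A, k ≤ n → n / k ∈ B) (hA : Syndetic A) : Syndetic B := by
  obtain ⟨M, hM⟩ := hA
  refine ⟨M + 1, fun i => ?_⟩
  obtain ⟨j, hj, hij, hji⟩ := hM (k * (i + 1))
  refine ⟨j / k, h j hj ((Nat.le_mul_of_pos_right k i.succ_pos).trans hij), ?_, ?_⟩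
  · rw [Nat.le_div_iff_mul_le hk]
    nlinarith
  · refine Nat.div_le_of_le_mul (hji.trans ?_)
    nlinarith

theorem card_inter_Iio_le (A : Set ℕ) (n : ℕ) : Nat.card ↥(A ∩ Set.Iio n) ≤ n := by
  simpa using Set.ncard_le_ncard (Set.inter_subset_right (s := A) (t := Set.Iio n))
    (Set.finite_Iio n)

theorem upperDensity_pos_iff {A : Set ℕ} :
    0 < upperDensity A ↔
      ∃ c > (0 : ℝ), ∃ᶠ n : ℕ in Filter.atTop, c * n ≤ Nat.card ↥(A ∩ Set.Iio n) := by
  have hnonneg : ∀ n : ℕ, (0 : ℝ) ≤ (Nat.card ↥(A ∩ Set.Iio n) : ℝ) / n :=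
    fun n => by positivity
  have hle : ∀ n : ℕ, (Nat.card ↥(A ∩ Set.Iio n) : ℝ) / n ≤ 1 := fun n =>
    div_le_one_of_le₀ (by exact_mod_cast card_inter_Iio_le A n) n.cast_nonneg
  constructor
  · intro h
    refine ⟨upperDensity A / 2, half_pos h, ?_⟩
    have hfreq := Filter.frequently_lt_of_lt_limsup
      (Filter.isCoboundedUnder_le_of_le Filter.atTop hnonneg)
      (show upperDensity A / 2 < upperDensity A from half_lt_self h)
    refine (hfreq.and_eventually (Filter.eventually_gt_atTop 0)).mono fun n hn => ?_
    exact ((lt_div_iff₀ (by exact_mod_cast hn.2)).1 hn.1).le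
  · rintro ⟨c, hc, h⟩
    refine hc.trans_le (Filter.le_limsup_of_frequently_le ?_
      (Filter.isBoundedUnder_of ⟨1, hle⟩))
    refine (h.and_eventually (Filter.eventually_gt_atTop 0)).mono fun n hn => ?_
    exact (le_div_iff₀ (by exact_mod_cast hn.2)).2 hn.1

theorem upperDensity_pos_of_mul_mem {A B : Set ℕ} {k : ℕ} (hk : 0 < k)
    (h : ∀ n ∈ A, k * n ∈ B) (hA : 0 < upperDensity A) : 0 < upperDensity B := by
  rw [upperDensity_pos_iff] at hA ⊢
  obtain ⟨c, hc, hfreq⟩ := hA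
  have hk' : (0 : ℝ) < k := by exact_mod_cast hk
  refine ⟨c / k, div_pos hc hk', ?_⟩
  refine (Filter.tendsto_id.const_mul_atTop' hk).frequently (hfreq.mono fun n hn => ?_)
  have hcard : Nat.card ↥(A ∩ Set.Iio n) ≤ Nat.card ↥(B ∩ Set.Iio (k * n)) :=
    Set.ncard_le_ncard_of_injOn (fun m => k * m)
      (fun m hm => ⟨h m hm.1, Nat.mul_lt_mul_of_pos_left hm.2 hk⟩)
      (fun a _ b _ hab => Nat.eq_of_mul_eq_mul_left hk hab)
      ((Set.finite_Iio _).inter_of_right _)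
  calc c / k * ((k * n : ℕ) : ℝ) = c * n := by push_cast; field_simp
    _ ≤ Nat.card ↥(A ∩ Set.Iio n) := hn
    _ ≤ _ := by exact_mod_cast hcard

theorem card_inter_Iio_le_of_div_mem {A B : Set ℕ} {k : ℕ} (hk : 0 < k)
    (h : ∀ n ∈ A, k ≤ n → n / k ∈ B) (n : ℕ) :
    Nat.card ↥(A ∩ Set.Iio n) ≤ k * (Nat.card ↥(B ∩ Set.Iio n) + 1) := by
  classical
  have hA : (A ∩ Set.Iio n).Finite := (Set.finite_Iio n).inter_of_right _
  have hB : (B ∩ Set.Iio n).Finite := (Set.finite_Iio n).inter_of_right _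
  have hfib := Finset.card_le_mul_card_image (f := fun m => m / k) hA.toFinset k fun b _ => by
    have hsub : {a ∈ hA.toFinset | a / k = b} ⊆ Finset.Ico (k * b) (k * b + k) := by
      intro a ha
      rw [Finset.mem_filter] at ha
      have hdm := Nat.div_add_mod a k
      have hlt := Nat.mod_lt a hk
      rw [ha.2] at hdm
      exact Finset.mem_Ico.2 ⟨by omega, by omega⟩
    simpa using Finset.card_le_card hsub
  have himg : hA.toFinset.image (fun m => m / k) ⊆ insert 0 hB.toFinset := by
    intro b hb
    obtain ⟨a, ha, rfl⟩ := Finset.mem_image.1 hb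
    rw [Set.Finite.mem_toFinset] at ha
    rcases lt_or_ge a k with hak | hak
    · simp [Nat.div_eq_of_lt hak]
    · exact Finset.mem_insert_of_mem <| hB.mem_toFinset.2
        ⟨h a ha.1 hak, (Nat.div_le_self a k).trans_lt ha.2⟩
  have hcA : Nat.card ↥(A ∩ Set.Iio n) = hA.toFinset.card := Set.ncard_eq_toFinset_card _ hA
  have hcB : Nat.card ↥(B ∩ Set.Iio n) = hB.toFinset.card := Set.ncard_eq_toFinset_card _ hB
  rw [hcA, hcB]
  exact hfib.trans <| Nat.mul_le_mul_left k <|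
    (Finset.card_le_card himg).trans (Finset.card_insert_le _ _)

theorem upperDensity_pos_of_div_mem {A B : Set ℕ} {k : ℕ} (hk : 0 < k)
    (h : ∀ n ∈ A, k ≤ n → n / k ∈ B) (hA : 0 < upperDensity A) : 0 < upperDensity B := by
  rw [upperDensity_pos_iff] at hA ⊢
  obtain ⟨c, hc, hfreq⟩ := hA
  have hk' : (0 : ℝ) < k := by exact_mod_cast hk
  refine ⟨c / (2 * k), by positivity, ?_⟩
  have hlarge : ∀ᶠ n : ℕ in Filter.atTop, 2 * k / c ≤ (n : ℝ) :=
    tendsto_natCast_atTop_atTop.eventually_ge_atTop _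
  refine (hfreq.and_eventually hlarge).mono fun n hn => ?_
  have hcard : (Nat.card ↥(A ∩ Set.Iio n) : ℝ) ≤ k * (Nat.card ↥(B ∩ Set.Iio n) + 1) := by
    exact_mod_cast card_inter_Iio_le_of_div_mem hk h n
  have hnc : 2 * k ≤ n * c := (div_le_iff₀ hc).1 hn.2
  rw [div_mul_eq_mul_div, div_le_iff₀ (by positivity)]
  linarith [hn.1]

/-- for a `k`-periodic NDS with `g = f_k ∘ ⋯ ∘ f_1`:
(i) syndetic (resp. ergodic) sensitivity of `(X, g)` implies syndetic (resp.
ergodic) sensitivity of `(X, f_{1,∞})`; (ii) conversely if each `f_p` is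
uniformly continuous. -/
theorem stmt15 {X : Type*} [MetricSpace X]
    (k : ℕ) (hk : 0 < k)
    (f : ℕ → X → X) (hcont : ∀ n, Continuous (f n))
    (hper : ∀ n, f (n + k) = f n) :
    (AutSyndeticallySensitive (compSeq f 0 k) → NDSSyndeticallySensitive f) ∧
    (AutErgodicallySensitive (compSeq f 0 k) → NDSErgodicallySensitive f) ∧
    ((∀ p, p < k → UniformContinuous (f p)) →
      NDSSyndeticallySensitive f → AutSyndeticallySensitive (compSeq f 0 k)) ∧
    ((∀ p, p < k → UniformContinuous (f p)) →
      NDSErgodicallySensitive f → AutErgodicallySensitive (compSeq f 0 k)) := by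
  refine ⟨?_, ?_, ?_, ?_⟩
  · rintro ⟨δ, hδ, H⟩
    exact ⟨δ, hδ, fun U hU hne =>
      (H U hU hne).of_mul_mem hk fun _ => mul_mem_NDSSensTimes hk hper⟩
  · rintro ⟨δ, hδ, H⟩
    exact ⟨δ, hδ, fun U hU hne =>
      upperDensity_pos_of_mul_mem hk (fun _ => mul_mem_NDSSensTimes hk hper) (H U hU hne)⟩
  · rintro huc ⟨δ, hδ, H⟩
    obtain ⟨η, hη, hlt⟩ := exists_dist_compSeq_lt huc hδ
    exact ⟨η, hη, fun U hU hne =>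
      (H U hU hne).of_div_mem hk fun _ hn hkn => div_mem_AutSensTimes hk hper hlt hkn hn⟩
  · rintro huc ⟨δ, hδ, H⟩
    obtain ⟨η, hη, hlt⟩ := exists_dist_compSeq_lt huc hδ
    exact ⟨η, hη, fun U hU hne => upperDensity_pos_of_div_mem hk
      (fun _ hn hkn => div_mem_AutSensTimes hk hper hlt hkn hn) (H U hU hne)⟩
end

section
/- Let (X, f_{1,∞}) be a non-autonomous discrete system on a metric space X without isolated points, where each f_i (i ∈ ℕ) is surjective. For n ≥ 2, let f_{n,∞} denote the shifted system (f_n, f_{n+1}, …). (i) If f_{1,∞} is sensitive, then f_{n,∞} is sensitive for every n ≥ 2. (ii) Conversely, if f_{1,∞} is feeble open and f_{n,∞} is sensitive for some n ≥ 2, then f_{1,∞} is sensitive. -/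
/-- Sensitivity of the shifted system `f_{s+1,∞}` (0-based start index `s`). -/
def NDSSensitiveFrom {X : Type*} [MetricSpace X] (f : ℕ → X → X) (s : ℕ) : Prop :=
  ∃ δ > (0 : ℝ), ∀ U : Set X, IsOpen U → U.Nonempty →
    ∃ x ∈ U, ∃ y ∈ U, ∃ m : ℕ, 0 < m ∧ δ < dist (compSeq f s m x) (compSeq f s m y)

/-- Feeble openness of `f_{1,∞}`. -/
def NDSFeebleOpen {X : Type*} [MetricSpace X] (f : ℕ → X → X) : Prop :=
  ∀ i : ℕ, ∀ U : Set X, IsOpen U → U.Nonempty → (interior (f i '' U)).Nonempty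

theorem compSeq_add {X : Type*} (f : ℕ → X → X) (i n m : ℕ) (x : X) :
    compSeq f i (n + m) x = compSeq f (i + n) m (compSeq f i n x) := by
  induction m with
  | zero => rfl
  | succ m ih =>
    change f (i + (n + m)) (compSeq f i (n + m) x) =
      f (i + n + m) (compSeq f (i + n) m (compSeq f i n x))
    rw [ih, Nat.add_assoc]

theorem continuous_compSeq {X : Type*} [TopologicalSpace X] {f : ℕ → X → X}
    (hf : ∀ n, Continuous (f n)) (i n : ℕ) : Continuous (compSeq f i n) := by
  induction n with
  | zero => exact continuous_id
  | succ n ih => exact (hf _).comp ih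

theorem surjective_compSeq {X : Type*} {f : ℕ → X → X}
    (hf : ∀ n, Function.Surjective (f n)) (i n : ℕ) :
    Function.Surjective (compSeq f i n) := by
  induction n with
  | zero => exact Function.surjective_id
  | succ n ih => exact (hf _).comp ih

theorem NDSFeebleOpen.interior_image_compSeq_nonempty {X : Type*} [MetricSpace X]
    {f : ℕ → X → X} (hf : NDSFeebleOpen f) (i n : ℕ) {U : Set X} (hU : IsOpen U)
    (hne : U.Nonempty) : (interior (compSeq f i n '' U)).Nonempty := by
  induction n with
  | zero =>
    change (interior (id '' U)).Nonempty
    rwa [Set.image_id, hU.interior_eq]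
  | succ n ih =>
    refine (hf (i + n) _ isOpen_interior ih).mono (interior_mono ?_)
    change _ ⊆ (f (i + n) ∘ compSeq f i n) '' U
    rw [Set.image_comp]
    exact Set.image_mono interior_subset

/-- Every point has a neighbourhood on which the first `s` iterates of a continuous system
vary by less than `δ`; sensitivity can therefore only be witnessed at later times. -/
theorem NDSSensitiveFrom.shift {X : Type*} [MetricSpace X] {f : ℕ → X → X}
    (hcont : ∀ n, Continuous (f n)) (hsurj : ∀ n, Function.Surjective (f n)) {i : ℕ}
    (h : NDSSensitiveFrom f i) (s : ℕ) : NDSSensitiveFrom f (i + s) := by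
  obtain ⟨δ, hδ, hsens⟩ := h
  refine ⟨δ, hδ, fun U hU ⟨u, hu⟩ => ?_⟩
  obtain ⟨x₀, rfl⟩ := surjective_compSeq hsurj i s u
  let W : Set X := compSeq f i s ⁻¹' U ∩
    ⋂ j ∈ Finset.range (s + 1), compSeq f i j ⁻¹' Metric.ball (compSeq f i j x₀) (δ / 2)
  have hW : IsOpen W := (hU.preimage (continuous_compSeq hcont i s)).inter
    (isOpen_biInter_finset fun j _ => Metric.isOpen_ball.preimage (continuous_compSeq hcont i j))
  have hx₀ : x₀ ∈ W := ⟨hu, Set.mem_iInter₂.2 fun j _ => Metric.mem_ball_self (half_pos hδ)⟩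
  obtain ⟨x, hx, y, hy, m, -, hm⟩ := hsens W hW ⟨x₀, hx₀⟩
  have hsm : s < m := by
    by_contra hle
    have hmem : m ∈ Finset.range (s + 1) := Finset.mem_range.2 (by omega)
    have hxm : dist _ _ < δ / 2 := Set.mem_iInter₂.1 hx.2 m hmem
    have hym : dist _ _ < δ / 2 := Set.mem_iInter₂.1 hy.2 m hmem
    linarith [dist_triangle_right (compSeq f i m x) (compSeq f i m y) (compSeq f i m x₀)]
  obtain ⟨k, rfl⟩ := Nat.exists_eq_add_of_lt hsm
  refine ⟨_, hx.1, _, hy.1, k + 1, k.succ_pos, ?_⟩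
  rwa [← compSeq_add, ← compSeq_add]

theorem NDSFeebleOpen.sensitiveFrom_of_shift {X : Type*} [MetricSpace X] {f : ℕ → X → X}
    (hf : NDSFeebleOpen f) {i s : ℕ} (h : NDSSensitiveFrom f (i + s)) :
    NDSSensitiveFrom f i := by
  obtain ⟨δ, hδ, hsens⟩ := h
  refine ⟨δ, hδ, fun U hU hne => ?_⟩
  obtain ⟨x', hx', y', hy', m, hm, hd⟩ :=
    hsens _ isOpen_interior (hf.interior_image_compSeq_nonempty i s hU hne)
  obtain ⟨x, hx, rfl⟩ := interior_subset hx'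
  obtain ⟨y, hy, rfl⟩ := interior_subset hy'
  refine ⟨x, hx, y, hy, s + m, by omega, ?_⟩
  rwa [compSeq_add, compSeq_add]

/-- for an NDS without isolated points with all maps surjective:
(i) if `f_{1,∞}` is sensitive then every shifted system `f_{n,∞}` (`n ≥ 2`) is
sensitive; (ii) if moreover `f_{1,∞}` is feeble open and some shifted system
`f_{n,∞}` (`n ≥ 2`) is sensitive, then `f_{1,∞}` is sensitive. -/
theorem stmt17 {X : Type*} [MetricSpace X]
    (hiso : ∀ x : X, Filter.NeBot (nhdsWithin x {x}ᶜ))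
    (f : ℕ → X → X) (hcont : ∀ n, Continuous (f n))
    (hsurj : ∀ n, Function.Surjective (f n)) :
    (NDSSensitiveFrom f 0 → ∀ s : ℕ, 1 ≤ s → NDSSensitiveFrom f s) ∧
    (NDSFeebleOpen f → (∃ s : ℕ, 1 ≤ s ∧ NDSSensitiveFrom f s) →
      NDSSensitiveFrom f 0) := by
  refine ⟨fun h s _ => ?_, fun hf ⟨s, _, h⟩ => ?_⟩
  · simpa only [Nat.zero_add] using h.shift hcont hsurj s
  · rw [← Nat.zero_add s] at h
    exact hf.sensitiveFrom_of_shift h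
end
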